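/- arXiv:math/0607713 — 3 statements merged into one kernel-verified Lean document; each statement's English description precedes it below -/
import Mathlib

section
/- Let A₁,…,A_n (n ≥ 1) be polynomial vector fields on ℂ^p and α, β ∈ ℕ^p. Then |coeff_α((D_{A₁} ∘ D_{A₂} ∘ … ∘ D_{A_n})(z^β))| ≤ ((deg(α)+n)!/deg(α)!) · m(A₁)·m(A₂)·…·m(A_n) · deg(β). -/
open MvPolynomial

noncomputable def vfDeriv {p : ℕ} (A : Fin p → MvPolynomial (Fin p) ℂ)
    (P : MvPolynomial (Fin p) ℂ) : MvPolynomial (Fin p) ℂ :=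
  ∑ i, A i * pderiv i P

noncomputable def vfNorm {p : ℕ} (A : Fin p → MvPolynomial (Fin p) ℂ) : ℝ :=
  ⨆ i, ∑ m ∈ (A i).support, ‖(A i).coeff m‖

def mdeg {p : ℕ} (k : Fin p →₀ ℕ) : ℕ := ∑ i, k i

/-- The composition `D_{A 0} ∘ D_{A 1} ∘ … ∘ D_{A n}` applied to `P`
(the last vector field acts first). -/
noncomputable def vfComp {p n : ℕ} (A : Fin n → Fin p → MvPolynomial (Fin p) ℂ)
    (P : MvPolynomial (Fin p) ℂ) : MvPolynomial (Fin p) ℂ :=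
  Fin.foldr n (fun j Q => vfDeriv (A j) Q) P


/-- The multi-indices of total degree at most `d`. -/
noncomputable def mdegLE (p d : ℕ) : Finset (Fin p →₀ ℕ) :=
  (Finset.Iic (Finsupp.equivFunOnFinite.symm fun _ => d)).filter fun k => mdeg k ≤ d

theorem mem_mdegLE {p d : ℕ} {k : Fin p →₀ ℕ} : k ∈ mdegLE p d ↔ mdeg k ≤ d := by
  simp only [mdegLE, Finset.mem_filter, Finset.mem_Iic, and_iff_right_iff_imp]
  intro h i
  exact (Finset.single_le_sum (f := fun i => k i) (fun _ _ => Nat.zero_le _)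
    (Finset.mem_univ i)).trans h

theorem mdeg_add {p : ℕ} (k l : Fin p →₀ ℕ) : mdeg (k + l) = mdeg k + mdeg l := by
  simp [mdeg, Finset.sum_add_distrib]

theorem mdeg_single {p : ℕ} (i : Fin p) (n : ℕ) : mdeg (Finsupp.single i n) = n := by
  simp [mdeg, Finsupp.single_apply]

theorem mdeg_mono {p : ℕ} {k l : Fin p →₀ ℕ} (h : k ≤ l) : mdeg k ≤ mdeg l :=
  Finset.sum_le_sum fun i _ => h i

theorem mdeg_le_mdeg_tsub_single_add_one {p : ℕ} (k : Fin p →₀ ℕ) (i : Fin p) :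
    mdeg k ≤ mdeg (k - Finsupp.single i 1) + 1 := by
  have h := mdeg_mono (le_tsub_add : k ≤ k - Finsupp.single i 1 + Finsupp.single i 1)
  rwa [mdeg_add, mdeg_single] at h

/-- The `ℓ¹` norm of the part of `P` of degree at most `d`. -/
noncomputable def truncNorm {p : ℕ} (d : ℕ) (P : MvPolynomial (Fin p) ℂ) : ℝ :=
  ∑ k ∈ mdegLE p d, ‖coeff k P‖

theorem truncNorm_nonneg {p : ℕ} (d : ℕ) (P : MvPolynomial (Fin p) ℂ) : 0 ≤ truncNorm d P :=
  Finset.sum_nonneg fun _ _ => norm_nonneg _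

theorem norm_coeff_le_truncNorm {p : ℕ} (k : Fin p →₀ ℕ) (P : MvPolynomial (Fin p) ℂ) :
    ‖coeff k P‖ ≤ truncNorm (mdeg k) P :=
  Finset.single_le_sum (f := fun k => ‖coeff k P‖) (fun _ _ => norm_nonneg _)
    (mem_mdegLE.2 le_rfl)

theorem truncNorm_sum_le {p : ℕ} {ι : Type*} (d : ℕ) (s : Finset ι)
    (P : ι → MvPolynomial (Fin p) ℂ) :
    truncNorm d (∑ i ∈ s, P i) ≤ ∑ i ∈ s, truncNorm d (P i) := by
  unfold truncNorm
  rw [Finset.sum_comm]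
  refine Finset.sum_le_sum fun k _ => ?_
  rw [coeff_sum]
  exact norm_sum_le _ _

theorem truncNorm_monomial {p : ℕ} (d : ℕ) (k : Fin p →₀ ℕ) (c : ℂ) :
    truncNorm d (monomial k c) = if mdeg k ≤ d then ‖c‖ else 0 := by
  simp [truncNorm, coeff_monomial, apply_ite norm, mem_mdegLE]

theorem truncNorm_mul_monomial_le {p : ℕ} (d : ℕ) (P : MvPolynomial (Fin p) ℂ)
    (k : Fin p →₀ ℕ) (c : ℂ) :
    truncNorm d (P * monomial k c) ≤
      if mdeg k ≤ d then (∑ m ∈ P.support, ‖P.coeff m‖) * ‖c‖ else 0 := by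
  conv_lhs => rw [P.as_sum, Finset.sum_mul]
  refine (truncNorm_sum_le _ _ _).trans ?_
  simp only [monomial_mul, truncNorm_monomial, mdeg_add, norm_mul]
  split_ifs with h
  · rw [Finset.sum_mul]
    refine Finset.sum_le_sum fun m _ => ?_
    split_ifs
    · exact le_rfl
    · positivity
  · refine (Finset.sum_eq_zero fun m _ => if_neg ?_).le
    omega

theorem sum_norm_coeff_le_vfNorm {p : ℕ} (A : Fin p → MvPolynomial (Fin p) ℂ) (i : Fin p) :
    ∑ m ∈ (A i).support, ‖(A i).coeff m‖ ≤ vfNorm A :=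
  le_ciSup (f := fun i => ∑ m ∈ (A i).support, ‖(A i).coeff m‖)
    (Set.finite_range _).bddAbove i

theorem vfNorm_nonneg {p : ℕ} (A : Fin p → MvPolynomial (Fin p) ℂ) : 0 ≤ vfNorm A :=
  Real.iSup_nonneg fun _ => Finset.sum_nonneg fun _ _ => norm_nonneg _

theorem truncNorm_vfDeriv_monomial_le {p : ℕ} (d : ℕ) (A : Fin p → MvPolynomial (Fin p) ℂ)
    (k : Fin p →₀ ℕ) (c : ℂ) :
    truncNorm d (vfDeriv A (monomial k c)) ≤
      if mdeg k ≤ d + 1 then vfNorm A * mdeg k * ‖c‖ else 0 := by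
  unfold vfDeriv
  refine (truncNorm_sum_le _ _ _).trans ?_
  simp only [pderiv_monomial]
  refine (Finset.sum_le_sum fun i _ => truncNorm_mul_monomial_le _ _ _ _).trans ?_
  split_ifs with h
  · have hk : vfNorm A * mdeg k * ‖c‖ = ∑ i, vfNorm A * ‖c * (k i : ℂ)‖ := by
      simp only [mdeg, norm_mul, Complex.norm_natCast, ← Finset.mul_sum]
      push_cast
      ring
    rw [hk]
    refine Finset.sum_le_sum fun i _ => ?_
    split_ifs
    · exact mul_le_mul_of_nonneg_right (sum_norm_coeff_le_vfNorm A i) (norm_nonneg _)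
    · exact mul_nonneg (vfNorm_nonneg A) (norm_nonneg _)
  · refine (Finset.sum_eq_zero fun i _ => if_neg ?_).le
    have := mdeg_le_mdeg_tsub_single_add_one k i
    omega

theorem vfDeriv_sum {p : ℕ} {ι : Type*} (A : Fin p → MvPolynomial (Fin p) ℂ) (s : Finset ι)
    (P : ι → MvPolynomial (Fin p) ℂ) :
    vfDeriv A (∑ j ∈ s, P j) = ∑ j ∈ s, vfDeriv A (P j) := by
  simp only [vfDeriv, map_sum, Finset.mul_sum]
  exact Finset.sum_comm

theorem truncNorm_vfDeriv_le {p : ℕ} (d : ℕ) (A : Fin p → MvPolynomial (Fin p) ℂ)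
    (P : MvPolynomial (Fin p) ℂ) :
    truncNorm d (vfDeriv A P) ≤ (d + 1) * vfNorm A * truncNorm (d + 1) P := by
  conv_lhs => rw [P.as_sum, vfDeriv_sum]
  refine (truncNorm_sum_le _ _ _).trans ?_
  refine (Finset.sum_le_sum fun k _ => truncNorm_vfDeriv_monomial_le d A k _).trans ?_
  rw [← Finset.sum_filter, truncNorm, Finset.mul_sum]
  refine (Finset.sum_le_sum (g := fun k => (d + 1) * vfNorm A * ‖coeff k P‖)
    fun k hk => ?_).trans (Finset.sum_le_sum_of_subset_of_nonneg ?_ fun k _ _ => ?_)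
  · have hd : (mdeg k : ℝ) ≤ d + 1 := by exact_mod_cast (Finset.mem_filter.1 hk).2
    rw [mul_comm (vfNorm A)]
    have := vfNorm_nonneg A
    gcongr
  · exact fun k hk => mem_mdegLE.2 (Finset.mem_filter.1 hk).2
  · have := vfNorm_nonneg A
    positivity

theorem vfComp_succ {p n : ℕ} (A : Fin (n + 1) → Fin p → MvPolynomial (Fin p) ℂ)
    (P : MvPolynomial (Fin p) ℂ) :
    vfComp A P = vfDeriv (A 0) (vfComp (fun j => A j.succ) P) := by
  simp only [vfComp, Fin.foldr_succ]

theorem truncNorm_vfComp_monomial_le {p : ℕ} (β : Fin p →₀ ℕ) (m d : ℕ)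
    (A : Fin (m + 1) → Fin p → MvPolynomial (Fin p) ℂ) :
    truncNorm d (vfComp A (monomial β 1)) ≤
      ((Nat.factorial (d + (m + 1)) : ℝ) / (Nat.factorial d : ℝ)) *
        (∏ j : Fin (m + 1), vfNorm (A j)) * (mdeg β : ℝ) := by
  induction m generalizing d with
  | zero =>
    have hA := vfNorm_nonneg (A 0)
    have hd : (d.factorial : ℝ) ≠ 0 := by positivity
    have h : truncNorm d (vfComp A (monomial β 1)) ≤ vfNorm (A 0) * mdeg β := by
      rw [vfComp_succ]
      refine (truncNorm_vfDeriv_monomial_le d (A 0) β 1).trans ?_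
      split_ifs
      · simp
      · positivity
    refine h.trans ?_
    have hf : ((d + (0 + 1)).factorial : ℝ) / d.factorial = d + 1 := by
      rw [zero_add, Nat.factorial_succ]
      push_cast
      field_simp
    rw [hf, Fin.prod_univ_one, mul_assoc]
    exact le_mul_of_one_le_left (by positivity) (by linarith [d.cast_nonneg (α := ℝ)])
  | succ m ih =>
    have hA := vfNorm_nonneg (A 0)
    rw [vfComp_succ]
    refine (truncNorm_vfDeriv_le d (A 0) _).trans
      ((mul_le_mul_of_nonneg_left (ih (d + 1) fun j => A j.succ) (by positivity)).trans_eq ?_)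
    rw [Fin.prod_univ_succ fun j => vfNorm (A j), Nat.factorial_succ d,
      show d + 1 + (m + 1) = d + (m + 1 + 1) by ring]
    have hd : (d.factorial : ℝ) ≠ 0 := by positivity
    push_cast
    field_simp

/-- `|coeff_α((D_{A₁} ∘ … ∘ D_{A_n})(z^β))| ≤
((deg α + n)!/deg α!)·m(A₁)·…·m(A_n)·deg β` for `n = m + 1 ≥ 1`. -/
theorem stmt_5 (p m : ℕ) (hp : 0 < p)
    (A : Fin (m + 1) → Fin p → MvPolynomial (Fin p) ℂ) (α β : Fin p →₀ ℕ) :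
    ‖coeff α (vfComp A (monomial β 1))‖ ≤
      ((Nat.factorial (mdeg α + (m + 1)) : ℝ) / (Nat.factorial (mdeg α) : ℝ)) *
        (∏ j : Fin (m + 1), vfNorm (A j)) * (mdeg β : ℝ) := by
  exact (norm_coeff_le_truncNorm α _).trans (truncNorm_vfComp_monomial_le β m (mdeg α) A)
end

section
/- Let A be a polynomial vector field on ℂ^p, β ∈ ℕ^p a multi-index, and t ∈ ℂ with |t|·m(A) < 1. Then the series Σ_{n≥0} (t^n/n!)·coeff_0(D_A^n(z^β)) converges absolutely, where coeff_0 denotes the constant coefficient and D_A^n the n-fold composition of D_A. -/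
open MvPolynomial

/-- The derivation `vfDeriv A` as a linear map. -/
noncomputable def vfDerivLinear {p : ℕ} (A : Fin p → MvPolynomial (Fin p) ℂ) :
    MvPolynomial (Fin p) ℂ →ₗ[ℂ] MvPolynomial (Fin p) ℂ :=
  ∑ i, (LinearMap.mulLeft ℂ (A i)).comp (pderiv i).toLinearMap

theorem vfDerivLinear_pow_apply {p : ℕ} (A : Fin p → MvPolynomial (Fin p) ℂ) (n : ℕ)
    (P : MvPolynomial (Fin p) ℂ) : (vfDerivLinear A ^ n) P = (vfDeriv A)^[n] P := by
  have h : ⇑(vfDerivLinear A) = vfDeriv A := by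
    ext1 P
    simp [vfDerivLinear, vfDeriv]
  rw [Module.End.pow_apply, h]

theorem vfDeriv_monomial {p : ℕ} (A : Fin p → MvPolynomial (Fin p) ℂ) (β : Fin p →₀ ℕ) :
    vfDeriv A (monomial β 1) = ∑ i, ∑ m ∈ (A i).support,
      ((A i).coeff m * (β i : ℂ)) • monomial (m + (β - Finsupp.single i 1)) (1 : ℂ) := by
  refine Finset.sum_congr rfl fun i _ => ?_
  conv_lhs => rw [(A i).as_sum]
  rw [pderiv_monomial, Finset.sum_mul]
  refine Finset.sum_congr rfl fun m _ => ?_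
  rw [monomial_mul, smul_monomial]
  simp

theorem coeff_zero_vfDeriv_iterate_succ {p : ℕ} (A : Fin p → MvPolynomial (Fin p) ℂ) (n : ℕ)
    (β : Fin p →₀ ℕ) :
    coeff 0 ((vfDeriv A)^[n + 1] (monomial β 1)) = ∑ i, ∑ m ∈ (A i).support,
      ((A i).coeff m * (β i : ℂ)) *
        coeff 0 ((vfDeriv A)^[n] (monomial (m + (β - Finsupp.single i 1)) 1)) := by
  rw [Function.iterate_succ_apply, vfDeriv_monomial, ← vfDerivLinear_pow_apply]
  simp only [map_sum, map_smul, coeff_sum, coeff_smul, smul_eq_mul, vfDerivLinear_pow_apply]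

/-- Each application of a vector field lowers the degree by at most one. -/
theorem coeff_zero_vfDeriv_iterate_eq_zero {p : ℕ} (A : Fin p → MvPolynomial (Fin p) ℂ) (n : ℕ)
    (β : Fin p →₀ ℕ) (h : n < β.degree) :
    coeff 0 ((vfDeriv A)^[n] (monomial β 1)) = 0 := by
  induction n generalizing β with
  | zero =>
    have hβ : β ≠ 0 := by
      rintro rfl
      simp at h
    simp [coeff_monomial, hβ]
  | succ n ih =>
    rw [coeff_zero_vfDeriv_iterate_succ]
    refine Finset.sum_eq_zero fun i _ => Finset.sum_eq_zero fun m _ => ?_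
    rcases Nat.eq_zero_or_pos (β i) with hi | hi
    · simp [hi]
    · rw [ih, mul_zero]
      have hle : Finsupp.single i 1 ≤ β := by simpa using Nat.succ_le_of_lt hi
      have hdeg := congrArg Finsupp.degree (tsub_add_cancel_of_le hle)
      rw [map_add, Finsupp.degree_single] at hdeg
      rw [map_add]
      omega

theorem norm_coeff_zero_vfDeriv_iterate_le {p : ℕ} (A : Fin p → MvPolynomial (Fin p) ℂ) (n : ℕ)
    (β : Fin p →₀ ℕ) :
    ‖coeff 0 ((vfDeriv A)^[n] (monomial β 1))‖ ≤ n.factorial * vfNorm A ^ n := by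
  have hA := vfNorm_nonneg A
  induction n generalizing β with
  | zero =>
    simp only [Function.iterate_zero, id_eq, coeff_monomial]
    split_ifs <;> simp
  | succ n ih =>
    rcases lt_or_ge (n + 1) β.degree with h | h
    · rw [coeff_zero_vfDeriv_iterate_eq_zero A _ β h, norm_zero]
      positivity
    rw [coeff_zero_vfDeriv_iterate_succ]
    calc
      _ ≤ ∑ i, ∑ m ∈ (A i).support,
          ‖(A i).coeff m‖ * ((β i : ℝ) * (n.factorial * vfNorm A ^ n)) := by
        refine norm_sum_le_of_le _ fun i _ => norm_sum_le_of_le _ fun m _ => ?_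
        rw [norm_mul, norm_mul, Complex.norm_natCast, mul_assoc]
        gcongr
        exact ih _
      _ ≤ ∑ i, vfNorm A * ((β i : ℝ) * (n.factorial * vfNorm A ^ n)) := by
        refine Finset.sum_le_sum fun i _ => ?_
        rw [← Finset.sum_mul]
        gcongr
        exact sum_norm_coeff_le_vfNorm A i
      _ = (β.degree : ℝ) * (n.factorial * vfNorm A ^ (n + 1)) := by
        rw [← Finset.mul_sum, ← Finset.sum_mul, Finsupp.degree_eq_sum]
        push_cast
        ring
      _ ≤ ((n + 1 : ℕ) : ℝ) * (n.factorial * vfNorm A ^ (n + 1)) := by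
        gcongr
      _ = _ := by
        rw [Nat.factorial_succ]
        push_cast
        ring

/-- if `|t|·m(A) < 1` then the series
`Σ_{n≥0} (t^n/n!)·coeff_0(D_A^n(z^β))` converges absolutely. -/
theorem stmt_7 (p : ℕ) (hp : 0 < p) (A : Fin p → MvPolynomial (Fin p) ℂ)
    (β : Fin p →₀ ℕ) (t : ℂ) (ht : ‖t‖ * vfNorm A < 1) :
    Summable fun n : ℕ =>
      ‖(t ^ n / (Nat.factorial n : ℂ)) *
        coeff 0 ((vfDeriv A)^[n] (monomial β 1))‖ := by
  refine Summable.of_nonneg_of_le (fun _ => norm_nonneg _) (fun n => ?_)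
    (summable_geometric_of_lt_one (mul_nonneg (norm_nonneg t) (vfNorm_nonneg A)) ht)
  have hn : (n.factorial : ℝ) ≠ 0 := by exact_mod_cast n.factorial_ne_zero
  rw [norm_mul, norm_div, norm_pow, Complex.norm_natCast]
  calc
    _ ≤ ‖t‖ ^ n / n.factorial * (n.factorial * vfNorm A ^ n) := by
      gcongr
      exact norm_coeff_zero_vfDeriv_iterate_le A n β
    _ = (‖t‖ * vfNorm A) ^ n := by
      rw [mul_pow]
      field_simp
end

section
/- Let A be a polynomial vector field on ℂ^p and x ∈ ℂ^p. Let A_x be the translated vector field with components A_x^i(z) = A^i(z + x), and assume t ∈ ℂ satisfies |t|·m(A_x) < 1. For i = 1,…,p define y_{i,x}(t) := Σ_{n≥0} (t^n/n!)·(D_A^n(z_i))(x), where (D_A^n(z_i))(x) is the evaluation at x of the polynomial D_A^n(z_i). Then each series converges absolutely, y_{i,x}(0) = x_i, each y_{i,x} is complex differentiable on {t : |t|·m(A_x) < 1}, and (d/dt)y_{i,x}(t) = A^i(y_{1,x}(t), …, y_{p,x}(t)), where A^i(w) denotes the evaluation of the polynomial A^i at w ∈ ℂ^p. -/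
open MvPolynomial

theorem vfDeriv_eq_mkDerivation {p : ℕ} (A : Fin p → MvPolynomial (Fin p) ℂ) :
    vfDeriv A = ⇑(mkDerivation ℂ A) := by
  funext P
  induction P using MvPolynomial.induction_on with
  | C a => simp [vfDeriv]
  | add P Q hP hQ =>
    rw [map_add, ← hP, ← hQ]
    simp only [vfDeriv, map_add, mul_add, Finset.sum_add_distrib]
  | mul_X P i hP =>
    have h : ∀ j, A j * pderiv j (P * X i) =
        P * (if j = i then A j else 0) + X i * (A j * pderiv j P) := by
      intro j
      rw [pderiv_mul, pderiv_X, Pi.single_apply]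
      rcases eq_or_ne j i with rfl | hj
      · simp only [if_true]; ring
      · rw [if_neg hj, if_neg hj.symm]; ring
    rw [Derivation.leibniz, ← hP, mkDerivation_X, vfDeriv, vfDeriv,
      Finset.sum_congr rfl fun j _ => h j, Finset.sum_add_distrib, ← Finset.mul_sum,
      ← Finset.mul_sum, Finset.sum_ite_eq' Finset.univ i, if_pos (Finset.mem_univ i),
      smul_eq_mul, smul_eq_mul]

/-- The `n`-th iterate of a derivation satisfies the general Leibniz rule. -/
theorem Derivation.iterate_mul {R S : Type*} [CommRing R] [CommRing S] [Algebra R S]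
    (D : Derivation R S S) (n : ℕ) (a b : S) :
    D^[n] (a * b) =
      ∑ ij ∈ Finset.HasAntidiagonal.antidiagonal n,
        (n.choose ij.1 : S) * (D^[ij.1] a * D^[ij.2] b) := by
  induction n with
  | zero => simp
  | succ n ih =>
    rw [Finset.sum_antidiagonal_choose_succ_mul (fun i j => D^[i] a * D^[j] b) n,
      Function.iterate_succ_apply', ih, map_sum, ← Finset.sum_add_distrib]
    refine Finset.sum_congr rfl fun ij hij => ?_
    rw [← Nat.choose_symm_of_eq_add (Finset.HasAntidiagonal.mem_antidiagonal.1 hij).symm]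
    have h : D ((n.choose ij.1 : ℕ) : S) = 0 := D.map_natCast _
    simp only [Derivation.leibniz, h, smul_eq_mul, Function.iterate_succ_apply']
    ring

theorem norm_linearMap_le_sum_norm_coeff_mul {σ : Type*} (f : MvPolynomial σ ℂ →ₗ[ℂ] ℂ)
    (P : MvPolynomial σ ℂ) {B : ℝ} (hB : ∀ m, ‖f (monomial m 1)‖ ≤ B) :
    ‖f P‖ ≤ (∑ m ∈ P.support, ‖P.coeff m‖) * B := by
  conv_lhs => rw [P.as_sum]
  rw [map_sum, Finset.sum_mul]
  refine (norm_sum_le _ _).trans (Finset.sum_le_sum fun m _ => ?_)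
  have h : monomial m (P.coeff m) = P.coeff m • monomial m (1 : ℂ) := by
    rw [smul_monomial, smul_eq_mul, mul_one]
  rw [h, map_smul, smul_eq_mul, norm_mul]
  exact mul_le_mul_of_nonneg_left (hB m) (norm_nonneg _)

theorem exists_linearMap_eq_eval_iterate_vfDeriv {p : ℕ} (A : Fin p → MvPolynomial (Fin p) ℂ)
    (n : ℕ) : ∃ f : MvPolynomial (Fin p) ℂ →ₗ[ℂ] ℂ, ∀ P, f P = eval 0 ((vfDeriv A)^[n] P) := by
  refine ⟨(aeval (0 : Fin p → ℂ)).toLinearMap ∘ₗ ((mkDerivation ℂ A).toLinearMap ^ n),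
    fun P => ?_⟩
  rw [LinearMap.comp_apply, Module.End.pow_apply, vfDeriv_eq_mkDerivation]
  rfl

/-- Since a derivation lowers degrees by at most one, only monomials of degree at most `n`
contribute to the constant coefficient of `n`-fold derivatives. -/
theorem norm_eval_zero_iterate_monomial_le {p : ℕ} (A : Fin p → MvPolynomial (Fin p) ℂ) (n : ℕ) :
    ∀ k : Fin p →₀ ℕ, ‖eval 0 ((vfDeriv A)^[n] (monomial k 1))‖ ≤
      if k.degree ≤ n then (n.factorial : ℝ) * vfNorm A ^ n else 0 := by
  have hm := vfNorm_nonneg A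
  induction n with
  | zero =>
    intro k
    by_cases hk : k = 0
    · simp [hk]
    · rw [Function.iterate_zero_apply, eval_zero, constantCoeff_monomial, if_neg hk, norm_zero]
      split_ifs <;> simp
  | succ n ih =>
    intro k
    obtain ⟨f, hfe⟩ := exists_linearMap_eq_eval_iterate_vfDeriv A n
    set B : ℝ := if k.degree ≤ n + 1 then (n.factorial : ℝ) * vfNorm A ^ n else 0 with hBdef
    have hB0 : 0 ≤ B := by rw [hBdef]; split_ifs <;> positivity
    have key : ∀ i ∈ k.support, ‖f (monomial (k - Finsupp.single i 1) (k i : ℂ) * A i)‖ ≤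
        k i * (vfNorm A * B) := by
      intro i hi
      have hdeg : (k - Finsupp.single i 1).degree + 1 = k.degree := by
        have h : k - Finsupp.single i 1 + Finsupp.single i 1 = k :=
          tsub_add_cancel_of_le (by
            rw [Finsupp.single_le_iff]
            exact Nat.one_le_iff_ne_zero.2 (Finsupp.mem_support_iff.1 hi))
        conv_rhs => rw [← h]
        simp
      have hmon : monomial (k - Finsupp.single i 1) (k i : ℂ) * A i =
          (k i : ℂ) • (monomial (k - Finsupp.single i 1) 1 * A i) := by
        rw [← smul_mul_assoc, smul_monomial, smul_eq_mul, mul_one]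
      rw [hmon, map_smul, norm_smul, Complex.norm_natCast]
      refine mul_le_mul_of_nonneg_left ?_ (Nat.cast_nonneg _)
      refine (norm_linearMap_le_sum_norm_coeff_mul
        (f ∘ₗ LinearMap.mulLeft ℂ (monomial (k - Finsupp.single i 1) 1)) (A i) (B := B)
        fun m => ?_).trans (mul_le_mul_of_nonneg_right (sum_norm_coeff_le_vfNorm A i) hB0)
      rw [LinearMap.comp_apply, LinearMap.mulLeft_apply, monomial_mul, mul_one, hfe]
      refine (ih _).trans ?_
      rw [hBdef, map_add]
      split_ifs
      · exact le_rfl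
      · omega
      · positivity
      · exact le_rfl
    rw [Function.iterate_succ_apply, ← hfe, vfDeriv_eq_mkDerivation, mkDerivation_monomial,
      one_smul, Finsupp.sum, map_sum]
    refine (norm_sum_le _ _).trans ((Finset.sum_le_sum key).trans ?_)
    rw [← Finset.sum_mul, ← Nat.cast_sum, ← Finsupp.degree_apply]
    rw [hBdef]
    split_ifs with h
    · rw [Nat.factorial_succ, Nat.cast_mul, pow_succ]
      have h' : (k.degree : ℝ) ≤ ((n + 1 : ℕ) : ℝ) := Nat.cast_le.2 h
      calc (k.degree : ℝ) * (vfNorm A * (n.factorial * vfNorm A ^ n))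
          ≤ ((n + 1 : ℕ) : ℝ) * (vfNorm A * (n.factorial * vfNorm A ^ n)) := by gcongr
        _ = _ := by ring
    · simp

theorem aeval_translate_vfDeriv {p : ℕ} (A : Fin p → MvPolynomial (Fin p) ℂ) (x : Fin p → ℂ)
    (P : MvPolynomial (Fin p) ℂ) :
    aeval (fun j : Fin p => X j + C (x j)) (vfDeriv A P) =
      vfDeriv (fun i => aeval (fun j : Fin p => X j + C (x j)) (A i))
        (aeval (fun j : Fin p => X j + C (x j)) P) := by
  simp only [vfDeriv_eq_mkDerivation]
  induction P using MvPolynomial.induction_on with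
  | C a => simp [algebraMap_eq]
  | add P Q hP hQ => simp only [map_add, hP, hQ]
  | mul_X P i hP =>
    simp only [Derivation.leibniz, map_add, map_mul, smul_eq_mul, hP, aeval_X, mkDerivation_X,
      derivation_C, add_zero]

theorem eval_iterate_vfDeriv_eq_eval_zero {p : ℕ} (A : Fin p → MvPolynomial (Fin p) ℂ)
    (x : Fin p → ℂ) (n : ℕ) (P : MvPolynomial (Fin p) ℂ) :
    eval x ((vfDeriv A)^[n] P) =
      eval 0 ((vfDeriv fun i => aeval (fun j : Fin p => X j + C (x j)) (A i))^[n]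
        (aeval (fun j : Fin p => X j + C (x j)) P)) := by
  have h : Function.Semiconj (aeval (fun j : Fin p => X j + C (x j))) (vfDeriv A)
      (vfDeriv fun i => aeval (fun j : Fin p => X j + C (x j)) (A i)) :=
    aeval_translate_vfDeriv A x
  rw [← (h.iterate_right n).eq]
  generalize (vfDeriv A)^[n] P = Q
  induction Q using MvPolynomial.induction_on with
  | C a => simp [algebraMap_eq]
  | add P Q hP hQ => simp only [map_add, hP, hQ]
  | mul_X P i hP => simp [hP]

/-- Cauchy-type estimate for iterated derivatives along a polynomial vector field. -/
theorem exists_norm_eval_iterate_vfDeriv_le {p : ℕ} (A : Fin p → MvPolynomial (Fin p) ℂ)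
    (x : Fin p → ℂ) (P : MvPolynomial (Fin p) ℂ) :
    ∃ K : ℝ, 0 ≤ K ∧ ∀ n : ℕ, ‖eval x ((vfDeriv A)^[n] P)‖ ≤ K * (n.factorial *
      vfNorm (fun i => aeval (fun j : Fin p => X j + C (x j)) (A i)) ^ n) := by
  refine ⟨∑ m ∈ (aeval (fun j : Fin p => X j + C (x j)) P).support,
    ‖(aeval (fun j : Fin p => X j + C (x j)) P).coeff m‖,
    Finset.sum_nonneg fun _ _ => norm_nonneg _, fun n => ?_⟩
  rw [eval_iterate_vfDeriv_eq_eval_zero]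
  set A' := fun i => aeval (fun j : Fin p => X j + C (x j)) (A i)
  obtain ⟨f, hfe⟩ := exists_linearMap_eq_eval_iterate_vfDeriv A' n
  rw [← hfe]
  refine norm_linearMap_le_sum_norm_coeff_mul f _ fun m => ?_
  rw [hfe]
  refine (norm_eval_zero_iterate_monomial_le A' n m).trans ?_
  have := vfNorm_nonneg A'
  split_ifs
  · exact le_rfl
  · positivity

/-- The Lie series of `P` along `A` at `x`. -/
noncomputable def lieSeries {p : ℕ} (A : Fin p → MvPolynomial (Fin p) ℂ) (x : Fin p → ℂ)
    (P : MvPolynomial (Fin p) ℂ) (s : ℂ) : ℂ :=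
  ∑' n : ℕ, (s ^ n / (Nat.factorial n : ℂ)) * eval x ((vfDeriv A)^[n] P)

section LieSeries

variable {p : ℕ} (A : Fin p → MvPolynomial (Fin p) ℂ) (x : Fin p → ℂ)

theorem exists_norm_lieSeries_term_le (P : MvPolynomial (Fin p) ℂ) :
    ∃ K : ℝ, 0 ≤ K ∧ ∀ (s : ℂ) (n : ℕ),
      ‖(s ^ n / (Nat.factorial n : ℂ)) * eval x ((vfDeriv A)^[n] P)‖ ≤
      K * (‖s‖ * vfNorm (fun i => aeval (fun j : Fin p => X j + C (x j)) (A i))) ^ n := by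
  obtain ⟨K, hK, h⟩ := exists_norm_eval_iterate_vfDeriv_le A x P
  refine ⟨K, hK, fun s n => ?_⟩
  have hn : (0 : ℝ) < n.factorial := by exact_mod_cast n.factorial_pos
  rw [norm_mul, norm_div, norm_pow, Complex.norm_natCast]
  refine (mul_le_mul_of_nonneg_left (h n) (by positivity)).trans (le_of_eq ?_)
  rw [mul_pow]
  field_simp

theorem summable_norm_lieSeries_term (P : MvPolynomial (Fin p) ℂ) {s : ℂ}
    (hs : ‖s‖ * vfNorm (fun i => aeval (fun j : Fin p => X j + C (x j)) (A i)) < 1) :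
    Summable fun n : ℕ => ‖(s ^ n / (Nat.factorial n : ℂ)) * eval x ((vfDeriv A)^[n] P)‖ := by
  obtain ⟨K, -, h⟩ := exists_norm_lieSeries_term_le A x P
  exact Summable.of_nonneg_of_le (fun _ => norm_nonneg _) (h s)
    ((summable_geometric_of_lt_one (mul_nonneg (norm_nonneg _) (vfNorm_nonneg _)) hs).mul_left K)

theorem lieSeries_zero_right (P : MvPolynomial (Fin p) ℂ) : lieSeries A x P 0 = eval x P := by
  rw [lieSeries, tsum_eq_single 0 fun n hn => by simp [hn]]
  simp

theorem lieSeries_C (a : ℂ) (s : ℂ) : lieSeries A x (C a) s = a := by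
  rw [lieSeries, tsum_eq_single 0]
  · simp
  · intro n hn
    obtain ⟨n, rfl⟩ := Nat.exists_eq_succ_of_ne_zero hn
    have h0 : (vfDeriv A)^[n] 0 = 0 := by
      rw [vfDeriv_eq_mkDerivation]
      exact Function.iterate_fixed (map_zero _) n
    have hC : vfDeriv A (C a) = 0 := by rw [vfDeriv_eq_mkDerivation, derivation_C]
    rw [Nat.succ_eq_add_one, Function.iterate_succ_apply, hC, h0, map_zero, mul_zero]

theorem lieSeries_add (P Q : MvPolynomial (Fin p) ℂ) {s : ℂ}
    (hs : ‖s‖ * vfNorm (fun i => aeval (fun j : Fin p => X j + C (x j)) (A i)) < 1) :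
    lieSeries A x (P + Q) s = lieSeries A x P s + lieSeries A x Q s := by
  rw [lieSeries, lieSeries, lieSeries,
    ← (summable_norm_lieSeries_term A x P hs).of_norm.tsum_add
      (summable_norm_lieSeries_term A x Q hs).of_norm]
  refine tsum_congr fun n => ?_
  rw [vfDeriv_eq_mkDerivation, iterate_map_add, map_add, mul_add]

theorem lieSeries_mul (P Q : MvPolynomial (Fin p) ℂ) {s : ℂ}
    (hs : ‖s‖ * vfNorm (fun i => aeval (fun j : Fin p => X j + C (x j)) (A i)) < 1) :
    lieSeries A x (P * Q) s = lieSeries A x P s * lieSeries A x Q s := by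
  rw [lieSeries, lieSeries, lieSeries,
    tsum_mul_tsum_eq_tsum_sum_antidiagonal_of_summable_norm
      (summable_norm_lieSeries_term A x P hs) (summable_norm_lieSeries_term A x Q hs)]
  refine tsum_congr fun n => ?_
  rw [vfDeriv_eq_mkDerivation, Derivation.iterate_mul, map_sum, Finset.mul_sum]
  refine Finset.sum_congr rfl fun ij hij => ?_
  obtain rfl := Finset.HasAntidiagonal.mem_antidiagonal.1 hij
  have h1 : ((ij.1.factorial : ℕ) : ℂ) ≠ 0 := Nat.cast_ne_zero.2 (Nat.factorial_ne_zero _)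
  have h2 : ((ij.2.factorial : ℕ) : ℂ) ≠ 0 := Nat.cast_ne_zero.2 (Nat.factorial_ne_zero _)
  have h3 : (((ij.1 + ij.2).factorial : ℕ) : ℂ) ≠ 0 :=
    Nat.cast_ne_zero.2 (Nat.factorial_ne_zero _)
  have h4 : ((ij.1 + ij.2).choose ij.1 : ℂ) * ij.1.factorial * ij.2.factorial =
      (ij.1 + ij.2).factorial := by
    rw [Nat.choose_symm_add]
    exact_mod_cast Nat.add_choose_mul_factorial_mul_factorial ij.1 ij.2
  rw [map_mul, map_mul, map_natCast, ← h4, pow_add]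
  have h5 : ((ij.1 + ij.2).choose ij.1 : ℂ) ≠ 0 := by
    intro h; rw [h] at h4; simp at h4; exact h3 h4.symm
  field_simp

theorem lieSeries_eq_eval (P : MvPolynomial (Fin p) ℂ) {s : ℂ}
    (hs : ‖s‖ * vfNorm (fun i => aeval (fun j : Fin p => X j + C (x j)) (A i)) < 1) :
    lieSeries A x P s = eval (fun j => lieSeries A x (X j) s) P := by
  induction P using MvPolynomial.induction_on with
  | C a => rw [lieSeries_C, eval_C]
  | add P Q hP hQ => rw [lieSeries_add A x P Q hs, hP, hQ, map_add]
  | mul_X P i hP => rw [lieSeries_mul A x P _ hs, hP, map_mul, eval_X]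

theorem hasDerivAt_lieSeries (P : MvPolynomial (Fin p) ℂ) {s : ℂ}
    (hs : ‖s‖ * vfNorm (fun i => aeval (fun j : Fin p => X j + C (x j)) (A i)) < 1) :
    HasDerivAt (lieSeries A x P) (lieSeries A x (vfDeriv A P) s) s := by
  set M := vfNorm (fun i => aeval (fun j : Fin p => X j + C (x j)) (A i))
  have hM0 : 0 ≤ M := vfNorm_nonneg _
  obtain ⟨r, hsr, hr⟩ : ∃ r, ‖s‖ < r ∧ r * M < 1 := by
    have h : ∀ᶠ r in nhdsWithin ‖s‖ (Set.Ioi ‖s‖), r * M < 1 :=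
      ((continuous_id.mul continuous_const).tendsto ‖s‖).eventually_lt_const hs
        |>.filter_mono nhdsWithin_le_nhds
    obtain ⟨r, hr, hsr⟩ := (h.and (self_mem_nhdsWithin (s := Set.Ioi ‖s‖))).exists
    exact ⟨r, hsr, hr⟩
  have hr0 : 0 ≤ r := (norm_nonneg s).trans hsr.le
  obtain ⟨K, hK, hb⟩ := exists_norm_lieSeries_term_le A x (vfDeriv A P)
  let g : ℕ → ℂ → ℂ := fun n z => z ^ n / (Nat.factorial n : ℂ) * eval x ((vfDeriv A)^[n] P)
  let g' : ℕ → ℂ → ℂ := fun n z => match n with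
    | 0 => 0
    | n + 1 => z ^ n / (Nat.factorial n : ℂ) * eval x ((vfDeriv A)^[n] (vfDeriv A P))
  let u : ℕ → ℝ := fun n => match n with
    | 0 => 0
    | n + 1 => K * (r * M) ^ n
  have hu : Summable u := (summable_nat_add_iff 1).1
    ((summable_geometric_of_lt_one (mul_nonneg hr0 hM0) hr).mul_left K)
  have hg : ∀ n, ∀ z ∈ Metric.ball (0 : ℂ) r, HasDerivAt (g n) (g' n z) z := by
    intro n z _
    cases n with
    | zero => simpa [g, g'] using hasDerivAt_const z (eval x P)
    | succ n =>
      have h := ((hasDerivAt_pow (n + 1) z).div_const ((n + 1).factorial : ℂ)).mul_const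
        (eval x ((vfDeriv A)^[n + 1] P))
      refine h.congr_deriv ?_
      have hn : ((n.factorial : ℕ) : ℂ) ≠ 0 := Nat.cast_ne_zero.2 n.factorial_ne_zero
      have hn' : ((n : ℂ) + 1) ≠ 0 := Nat.cast_add_one_ne_zero n
      simp only [g', Function.iterate_succ_apply, Nat.factorial_succ, Nat.cast_mul, Nat.cast_add,
        Nat.cast_one, Nat.add_sub_cancel]
      field_simp
  have hg' : ∀ n, ∀ z ∈ Metric.ball (0 : ℂ) r, ‖g' n z‖ ≤ u n := by
    intro n z hz
    cases n with
    | zero => simp [g', u]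
    | succ n =>
      refine (hb z n).trans ?_
      have hz' : ‖z‖ ≤ r := (mem_ball_zero_iff.1 hz).le
      simp only [u]
      gcongr
  have hsb : s ∈ Metric.ball (0 : ℂ) r := mem_ball_zero_iff.2 hsr
  have hder := hasDerivAt_tsum_of_isPreconnected hu Metric.isOpen_ball
    (convex_ball (0 : ℂ) r).isPreconnected hg hg' hsb
    (summable_norm_lieSeries_term A x P hs).of_norm hsb
  have hsum : Summable fun n => g' n s :=
    Summable.of_norm_bounded hu fun n => hg' n s hsb
  rw [hsum.tsum_eq_zero_add] at hder
  simp only [g', zero_add] at hder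
  exact hder

end LieSeries

/-- with `A_x^i(z) = A^i(z+x)` and `|t|·m(A_x) < 1`, the series
`y_{i,x}(t) := Σ_{n≥0} (t^n/n!)·(D_A^n(z_i))(x)` converge absolutely, `y_{i,x}(0) = x_i`,
each `y_{i,x}` is complex differentiable on `{s : |s|·m(A_x) < 1}`, and
`y_{i,x}'(s) = A^i(y_{1,x}(s), …, y_{p,x}(s))` there. -/
theorem stmt_15 (p : ℕ) (hp : 0 < p) (A : Fin p → MvPolynomial (Fin p) ℂ)
    (x : Fin p → ℂ) (t : ℂ)
    (ht : ‖t‖ * vfNorm (fun i => aeval (fun j : Fin p => X j + C (x j)) (A i)) < 1) :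
    let y : Fin p → ℂ → ℂ := fun i s =>
      ∑' n : ℕ, (s ^ n / (Nat.factorial n : ℂ)) * eval x ((vfDeriv A)^[n] (X i))
    (∀ i : Fin p, Summable fun n : ℕ =>
      ‖(t ^ n / (Nat.factorial n : ℂ)) * eval x ((vfDeriv A)^[n] (X i))‖) ∧
    (∀ i : Fin p, y i 0 = x i) ∧
    (∀ i : Fin p, ∀ s : ℂ,
      ‖s‖ * vfNorm (fun i' => aeval (fun j : Fin p => X j + C (x j)) (A i')) < 1 →
      HasDerivAt (y i) (eval (fun j => y j s) (A i)) s) := by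
  refine ⟨fun i => summable_norm_lieSeries_term A x (X i) ht, fun i => ?_, fun i s hs => ?_⟩
  · exact (lieSeries_zero_right A x (X i)).trans (eval_X i)
  · have h := hasDerivAt_lieSeries A x (X i) hs
    rw [lieSeries_eq_eval A x _ hs, vfDeriv_eq_mkDerivation, mkDerivation_X] at h
    exact h
end
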